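/- Fix a positive integer k. For every ε > 0 there exists a constant C = C(k,ε) > 0 such that for every prime p and every interval I ⊂ F_p not containing 0, the number J_{2k} of tuples (x_1,…,x_{2k}) ∈ I^{2k} satisfying x_1^{-1} + … + x_k^{-1} = x_{k+1}^{-1} + … + x_{2k}^{-1} in F_p satisfies J_{2k} ≤ C·(|I|^{2k²/(k+1)} + |I|^{2k}/p)·|I|^{ε}. -/

import Mathlib

open Finset

/-- The interval `{a+1, a+2, …, a+N}` in `ZMod p`. -/
def interval (p : ℕ) (a : ZMod p) (N : ℕ) : Finset (ZMod p) :=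
  (Finset.Icc 1 N).image (fun i : ℕ => a + (i : ZMod p))

/-- The number of pairs `(x, y)` of `k`-tuples from `s` such that
`f (x 1) + ⋯ + f (x k) = f (y 1) + ⋯ + f (y k)`. -/
def additiveEnergy {ι G : Type*} [AddCommMonoid G] [DecidableEq G] (k : ℕ) (s : Finset ι)
    (f : ι → G) : ℕ :=
  (((Fintype.piFinset fun _ : Fin k => s) ×ˢ Fintype.piFinset fun _ : Fin k => s).filter
    (fun xy => ∑ i, f (xy.1 i) = ∑ i, f (xy.2 i))).card

lemma AddChar.map_finset_sum {ι G : Type*} [AddCommMonoid G] (ψ : AddChar G ℂ) (s : Finset ι)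
    (g : ι → G) : ψ (∑ i ∈ s, g i) = ∏ i ∈ s, ψ (g i) := by
  classical
  induction s using Finset.induction_on with
  | empty => simp
  | insert a s ha ih => rw [sum_insert ha, prod_insert ha, AddChar.map_add_eq_mul, ih]

lemma norm_sum_addChar_pow {ι G : Type*} [AddCommGroup G] [Finite G] (k : ℕ) (s : Finset ι)
    (f : ι → G) (ψ : AddChar G ℂ) :
    ((‖∑ i ∈ s, ψ (f i)‖ ^ (2 * k) : ℝ) : ℂ) =
      ∑ xy ∈ (Fintype.piFinset fun _ : Fin k => s) ×ˢ Fintype.piFinset fun _ : Fin k => s,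
        ψ (∑ i, f (xy.1 i) - ∑ i, f (xy.2 i)) := by
  have h : ((‖∑ i ∈ s, ψ (f i)‖ ^ (2 * k) : ℝ) : ℂ) =
      (∑ i ∈ s, ψ (f i)) ^ k * (∑ i ∈ s, ψ (-f i)) ^ k := by
    have h' : (∑ i ∈ s, ψ (-f i)) = (starRingEnd ℂ) (∑ i ∈ s, ψ (f i)) := by
      rw [map_sum]
      exact sum_congr rfl fun i _ => AddChar.map_neg_eq_conj ψ (f i)
    rw [h', ← mul_pow, Complex.mul_conj, Complex.normSq_eq_norm_sq, pow_mul]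
    push_cast
    rfl
  rw [h, sum_pow', sum_pow', sum_mul_sum, sum_product]
  refine sum_congr rfl fun x _ => sum_congr rfl fun y _ => ?_
  rw [sub_eq_add_neg, ← sum_neg_distrib, AddChar.map_add_eq_mul, AddChar.map_finset_sum,
    AddChar.map_finset_sum]

lemma card_mul_additiveEnergy {ι G : Type*} [AddCommGroup G] [Fintype G] [DecidableEq G]
    (k : ℕ) (s : Finset ι) (f : ι → G) :
    (Fintype.card G : ℝ) * additiveEnergy k s f =
      ∑ ψ : AddChar G ℂ, ‖∑ i ∈ s, ψ (f i)‖ ^ (2 * k) := by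
  apply Complex.ofReal_injective
  rw [Complex.ofReal_sum]
  simp_rw [norm_sum_addChar_pow]
  rw [sum_comm]
  simp_rw [AddChar.sum_apply_eq_ite, sub_eq_zero]
  rw [← sum_filter, sum_const, additiveEnergy]
  push_cast
  rw [nsmul_eq_mul, mul_comm]

/-- Hölder's inequality for the additive energy of a superposition of families. -/
lemma pow_mul_additiveEnergy_le {ι κ τ G : Type*} [AddCommGroup G] [Fintype G] [DecidableEq G]
    {k : ℕ} (hk : 0 < k) (c : ℕ) (s : Finset ι) (f : ι → G) (t : Finset τ)
    (s' : τ → Finset κ) (f' : τ → κ → G)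
    (h : ∀ ψ : AddChar G ℂ,
      (c : ℂ) * ∑ i ∈ s, ψ (f i) = ∑ j ∈ t, ∑ i ∈ s' j, ψ (f' j i)) :
    c ^ (2 * k) * additiveEnergy k s f ≤
      t.card ^ (2 * k - 1) * ∑ j ∈ t, additiveEnergy k (s' j) (f' j) := by
  have hG : (0 : ℝ) < Fintype.card G := by exact_mod_cast Fintype.card_pos
  have key : (Fintype.card G : ℝ) * ((c : ℝ) ^ (2 * k) * additiveEnergy k s f) ≤
      Fintype.card G * ((t.card : ℝ) ^ (2 * k - 1) *
        ∑ j ∈ t, (additiveEnergy k (s' j) (f' j) : ℝ)) := by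
    calc (Fintype.card G : ℝ) * ((c : ℝ) ^ (2 * k) * additiveEnergy k s f)
        = ∑ ψ : AddChar G ℂ, ‖(c : ℂ) * ∑ i ∈ s, ψ (f i)‖ ^ (2 * k) := by
          rw [mul_left_comm, card_mul_additiveEnergy, mul_sum]
          refine sum_congr rfl fun ψ _ => ?_
          rw [norm_mul, mul_pow, Complex.norm_natCast]
      _ ≤ ∑ ψ : AddChar G ℂ, (t.card : ℝ) ^ (2 * k - 1) *
            ∑ j ∈ t, ‖∑ i ∈ s' j, ψ (f' j i)‖ ^ (2 * k) := by
          refine sum_le_sum fun ψ _ => ?_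
          rw [h ψ]
          have h1 : ‖∑ j ∈ t, ∑ i ∈ s' j, ψ (f' j i)‖ ^ (2 * k) ≤
              (∑ j ∈ t, ‖∑ i ∈ s' j, ψ (f' j i)‖) ^ (2 * k) := by
            gcongr
            exact norm_sum_le _ _
          refine h1.trans ?_
          have h2 := pow_sum_le_card_mul_sum_pow (s := t)
            (f := fun j => ‖∑ i ∈ s' j, ψ (f' j i)‖) (fun j _ => norm_nonneg _) (2 * k - 1)
          rwa [Nat.sub_add_cancel (by lia)] at h2
      _ = _ := by
          rw [← mul_sum, sum_comm, mul_left_comm, mul_sum t _ (Fintype.card G : ℝ)]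
          simp_rw [card_mul_additiveEnergy]
  exact_mod_cast le_of_mul_le_mul_left key hG

lemma additiveEnergy_le_of_injOn {ι G : Type*} [AddCommGroup G] [DecidableEq G]
    {k : ℕ} (hk : 0 < k) (s : Finset ι) (f : ι → G) (hf : Set.InjOn f s) :
    additiveEnergy k s f ≤ s.card ^ (2 * k - 1) := by
  classical
  obtain ⟨k, rfl⟩ := Nat.exists_eq_add_of_lt hk
  rw [Nat.zero_add] at *
  have hcard : ((Fintype.piFinset fun _ : Fin (k + 1) => s) ×ˢ
      Fintype.piFinset fun _ : Fin k => s).card = s.card ^ (2 * (k + 1) - 1) := by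
    rw [card_product, Fintype.card_piFinset_const, Fintype.card_piFinset_const, ← pow_add]
    congr 1
    lia
  rw [← hcard]
  refine card_le_card_of_injOn (fun xy => (xy.1, Fin.tail xy.2)) ?_ ?_
  · rintro ⟨x, y⟩ h
    simp only [coe_filter, mem_product, Fintype.mem_piFinset, Set.mem_ofPred_eq, coe_product,
      Set.mem_prod, mem_coe] at h ⊢
    exact ⟨h.1.1, fun i => h.1.2 i.succ⟩
  · rintro ⟨x, y⟩ h ⟨x', y'⟩ h' heq
    simp only [coe_filter, mem_product, Fintype.mem_piFinset, Set.mem_ofPred_eq] at h h'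
    simp only [Prod.mk.injEq] at heq
    obtain ⟨rfl, ht⟩ := heq
    have hs : ∀ i, y (Fin.succ i) = y' (Fin.succ i) := fun i => congrFun ht i
    have h0 : f (y 0) = f (y' 0) := by
      have := h.2.symm.trans h'.2
      rw [Fin.sum_univ_succ, Fin.sum_univ_succ] at this
      simpa [hs] using this
    have h0' := hf (h.1.2 0) (h'.1.2 0) h0
    refine Prod.ext rfl (funext fun i => ?_)
    exact Fin.cases h0' hs i

lemma exists_card_divisors_le (δ : ℝ) (hδ : 0 < δ) :
    ∃ C : ℝ, 1 ≤ C ∧ ∀ n : ℕ, n ≠ 0 → (n.divisors.card : ℝ) ≤ C * (n : ℝ) ^ δ := by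
  have hlog : 0 < Real.log 2 := Real.log_pos (by norm_num)
  set K : ℝ := 1 + 1 / (δ * Real.log 2) with hK
  have hK1 : 1 ≤ K := by
    rw [hK]
    have : 0 < 1 / (δ * Real.log 2) := by positivity
    linarith
  obtain ⟨P, hP⟩ := exists_nat_ge ((2 : ℝ) ^ (1 / δ))
  refine ⟨K ^ P, one_le_pow₀ hK1, fun n hn => ?_⟩
  have hlocal : ∀ q ∈ n.primeFactors, ((n.factorization q + 1 : ℕ) : ℝ) ≤
      (if q < P then K else 1) * ((q : ℝ) ^ n.factorization q) ^ δ := by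
    intro q hq
    have hq2 : (2 : ℝ) ≤ q := by exact_mod_cast (Nat.prime_of_mem_primeFactors hq).two_le
    set e := n.factorization q
    have hpow : ((q : ℝ) ^ e) ^ δ = ((q : ℝ) ^ δ) ^ e := by
      rw [← Real.rpow_natCast, ← Real.rpow_natCast, ← Real.rpow_mul (by positivity),
        ← Real.rpow_mul (by positivity), mul_comm]
    split_ifs with hqP
    · have h1 : 1 + e * (δ * Real.log 2) ≤ ((q : ℝ) ^ e) ^ δ := by
        calc 1 + e * (δ * Real.log 2) ≤ Real.exp (e * (δ * Real.log 2)) := by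
              linarith [Real.add_one_le_exp (e * (δ * Real.log 2))]
          _ = ((2 : ℝ) ^ e) ^ δ := by
              rw [← Real.rpow_natCast, ← Real.rpow_mul (by norm_num),
                Real.rpow_def_of_pos (by norm_num)]
              ring_nf
          _ ≤ _ := by gcongr
      calc ((e + 1 : ℕ) : ℝ) ≤ K * (1 + e * (δ * Real.log 2)) := by
            have : K * (1 + e * (δ * Real.log 2)) =
                1 + e + e * (δ * Real.log 2) + 1 / (δ * Real.log 2) := by
              rw [hK]; field_simp; ring
            rw [this]
            push_cast
            have h3 : 0 ≤ e * (δ * Real.log 2) := by positivity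
            have h4 : 0 < 1 / (δ * Real.log 2) := by positivity
            linarith
        _ ≤ _ := by gcongr
    · have h2 : (2 : ℝ) ≤ (q : ℝ) ^ δ := by
        have hq' : (2 : ℝ) ^ (1 / δ) ≤ q := hP.trans (by exact_mod_cast not_lt.mp hqP)
        calc (2 : ℝ) = ((2 : ℝ) ^ (1 / δ)) ^ δ := by
              rw [← Real.rpow_mul (by norm_num), one_div_mul_cancel hδ.ne', Real.rpow_one]
          _ ≤ _ := by gcongr
      rw [one_mul, hpow]
      calc ((e + 1 : ℕ) : ℝ) ≤ (2 : ℝ) ^ e := by exact_mod_cast Nat.lt_two_pow_self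
        _ ≤ _ := by gcongr
  rw [Nat.card_divisors hn]
  push_cast at hlocal ⊢
  refine (prod_le_prod (fun _ _ => by positivity) hlocal).trans ?_
  rw [prod_mul_distrib]
  have hprod : ∏ q ∈ n.primeFactors, ((q : ℝ) ^ n.factorization q) ^ δ = (n : ℝ) ^ δ := by
    rw [Real.finsetProd_rpow _ _ (fun _ _ => by positivity)]
    congr 1
    conv_rhs => rw [← Nat.prod_factorization_pow_eq_self hn]
    rw [Finsupp.prod, Nat.support_factorization]
    push_cast
    rfl
  rw [hprod]
  gcongr
  rw [prod_ite, prod_const, prod_const_one, mul_one]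
  refine pow_le_pow_right₀ hK1 ?_
  calc _ ≤ (range P).card := card_le_card fun q hq => by
        rw [mem_range]; exact (mem_filter.mp hq).2
    _ = P := card_range P

lemma card_roots_sum_inv_le {F : Type*} [Field F] [Fintype F] [DecidableEq F] {k : ℕ}
    (hk : ∀ m : ℕ, 0 < m → m ≤ k → (m : F) ≠ 0) (v w : Fin k → F)
    (j : Fin k) (hj : ∀ i, v i ≠ w j) :
    (univ.filter fun z : F => (∀ i, z + v i ≠ 0) ∧ (∀ i, z + w i ≠ 0) ∧
      ∑ i, (z + v i)⁻¹ = ∑ i, (z + w i)⁻¹).card ≤ 2 * k := by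
  classical
  set T : Finset F := univ.image v ∪ univ.image w with hT
  set m : F → F := fun c =>
    ((univ.filter fun i => v i = c).card : F) - ((univ.filter fun i => w i = c).card : F) with hm
  set P : Polynomial F := ∑ c ∈ T, Polynomial.C (m c) *
    ∏ d ∈ T.erase c, (Polynomial.X + Polynomial.C d) with hP
  have hTcard : T.card ≤ 2 * k := by
    refine (card_union_le _ _).trans ?_
    have h1 := card_image_le (s := (univ : Finset (Fin k))) (f := v)
    have h2 := card_image_le (s := (univ : Finset (Fin k))) (f := w)
    simp only [card_univ, Fintype.card_fin] at h1 h2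
    lia
  have hdeg : P.natDegree ≤ 2 * k := by
    refine Polynomial.natDegree_sum_le_of_forall_le _ _ fun c _ => ?_
    refine (Polynomial.natDegree_C_mul_le _ _).trans ?_
    refine (Polynomial.natDegree_prod_le _ _).trans ?_
    simp only [Polynomial.natDegree_X_add_C, sum_const, smul_eq_mul, mul_one]
    exact (card_erase_le).trans hTcard
  have hwT : w j ∈ T := by simp [hT]
  have hmw : m (w j) ≠ 0 := by
    have h0 : (univ.filter fun i => v i = w j) = ∅ := by
      simp [hj]
    simp only [hm, h0, card_empty, Nat.cast_zero, zero_sub, neg_ne_zero]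
    refine hk _ (card_pos.mpr ⟨j, by simp⟩) ?_
    simpa using card_le_univ (univ.filter fun i => w i = w j)
  have hP0 : P ≠ 0 := by
    intro h
    have he : P.eval (-w j) = m (w j) * ∏ d ∈ T.erase (w j), (-w j + d) := by
      rw [hP, Polynomial.eval_finsetSum, sum_eq_single (w j)]
      · simp [Polynomial.eval_prod]
      · intro c hc hcw
        rw [Polynomial.eval_mul, Polynomial.eval_prod,
          prod_eq_zero (i := w j) (mem_erase.mpr ⟨hcw.symm, hwT⟩) (by simp), mul_zero]
      · exact fun h => absurd hwT h
    rw [h, Polynomial.eval_zero] at he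
    refine mul_ne_zero hmw (prod_ne_zero_iff.mpr fun d hd hd0 => ?_) he.symm
    exact (mem_erase.mp hd).1 (by linear_combination hd0)
  have hfib : ∀ (x : Fin k → F) (z : F), univ.image x ⊆ T → ∑ i, (z + x i)⁻¹ =
      ∑ c ∈ T, ((univ.filter fun i => x i = c).card : F) * (z + c)⁻¹ := by
    intro x z hx
    rw [← sum_fiberwise_of_maps_to (s := univ) (t := T) (g := x)
      (fun i _ => hx (mem_image_of_mem x (mem_univ i)))]
    refine sum_congr rfl fun c _ => ?_
    rw [sum_congr rfl (g := fun _ => (z + c)⁻¹)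
      (fun i hi => by rw [(mem_filter.mp hi).2]), sum_const, nsmul_eq_mul]
  have hsub : (univ.filter fun z : F => (∀ i, z + v i ≠ 0) ∧ (∀ i, z + w i ≠ 0) ∧
      ∑ i, (z + v i)⁻¹ = ∑ i, (z + w i)⁻¹) ⊆ P.roots.toFinset := by
    intro z hz
    obtain ⟨-, hzv, hzw, hz⟩ := mem_filter.mp hz
    rw [hfib v z subset_union_left, hfib w z subset_union_right, ← sub_eq_zero,
      ← sum_sub_distrib] at hz
    have hzT : ∀ c ∈ T, z + c ≠ 0 := by
      intro c hc
      simp only [hT, mem_union, mem_image, mem_univ, true_and] at hc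
      rcases hc with ⟨i, rfl⟩ | ⟨i, rfl⟩
      · exact hzv i
      · exact hzw i
    rw [Multiset.mem_toFinset, Polynomial.mem_roots hP0, Polynomial.IsRoot.def, hP,
      Polynomial.eval_finsetSum]
    have : ∀ c ∈ T, (Polynomial.C (m c) *
        ∏ d ∈ T.erase c, (Polynomial.X + Polynomial.C d)).eval z =
        (∏ d ∈ T, (z + d)) * (((univ.filter fun i => v i = c).card : F) * (z + c)⁻¹ -
          ((univ.filter fun i => w i = c).card : F) * (z + c)⁻¹) := by
      intro c hc
      rw [← mul_prod_erase T _ hc]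
      simp only [Polynomial.eval_mul, Polynomial.eval_C, Polynomial.eval_prod,
        Polynomial.eval_add, Polynomial.eval_X, hm]
      field_simp [hzT c hc]
    rw [sum_congr rfl this, ← mul_sum, hz, mul_zero]
  calc _ ≤ P.roots.toFinset.card := card_le_card hsub
    _ ≤ P.roots.card := Multiset.toFinset_card_le _
    _ ≤ P.natDegree := P.card_roots'
    _ ≤ 2 * k := hdeg

/-- For a nonzero residue `x`, at least half of the `u ≤ U` are such that `x / u` is not a quotient
`h / d` with `d` small and `t = h * u` at most `M` in absolute value. -/
lemma exists_subset_forall_not_dvd {p : ℕ} (hp : p.Prime) {U D M : ℕ} (hU : 0 < U) (hD : 0 < D)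
    (hUp : U < p) (hM : 2 * M < p)
    (hdiv : ∀ n : ℕ, n ≠ 0 → n ≤ M → n.divisors.card ≤ D) {x : ZMod p} (hx : x ≠ 0) :
    ∃ G ⊆ Icc 1 U, G.card = U - U / 2 ∧ ∀ u ∈ G, ∀ d : ℕ, 0 < d → d * (2 * D) ≤ U →
      ∀ t : ℤ, |t| ≤ M → (t : ZMod p) = x * d → ¬ (u : ℤ) ∣ t := by
  classical
  have := Fact.mk hp
  set B : ℕ → Finset ℕ := fun d => (Icc 1 U).filter fun u =>
    ∃ t : ℤ, |t| ≤ M ∧ (t : ZMod p) = x * d ∧ (u : ℤ) ∣ t with hB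
  set bad := (Icc 1 (U / (2 * D))).biUnion B with hbad
  have hBd : ∀ d ∈ Icc 1 (U / (2 * D)), (B d).card ≤ D := by
    intro d hd
    obtain ⟨hd1, hd2⟩ := mem_Icc.mp hd
    have hdp : d < p := (hd2.trans (Nat.div_le_self _ _)).trans_lt hUp
    by_cases h : ∃ t : ℤ, |t| ≤ M ∧ (t : ZMod p) = x * d
    · obtain ⟨t, ht, htx⟩ := h
      have ht0 : t ≠ 0 := by
        rintro rfl
        rw [Int.cast_zero] at htx
        rcases mul_eq_zero.mp htx.symm with h | h
        · exact hx h
        · rw [ZMod.natCast_eq_zero_iff] at h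
          exact absurd (Nat.le_of_dvd hd1 h) (by lia)
      refine (card_le_card (t := t.natAbs.divisors) ?_).trans
        (hdiv _ (Int.natAbs_ne_zero.mpr ht0) (by rw [abs_le] at ht; lia))
      intro u hu
      obtain ⟨-, t', ht', htx', hut⟩ := mem_filter.mp hu
      have : t' = t := by
        have h1 : ((t' - t : ℤ) : ZMod p) = 0 := by
          rw [Int.cast_sub, htx, htx', sub_self]
        rw [ZMod.intCast_zmod_eq_zero_iff_dvd] at h1
        have := Int.eq_zero_of_abs_lt_dvd h1 (by
          have := abs_sub t' t
          lia)
        lia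
      subst this
      rw [Nat.mem_divisors]
      exact ⟨Int.natCast_dvd.mp hut, Int.natAbs_ne_zero.mpr ht0⟩
    · have : B d = ∅ := by
        rw [hB]
        refine filter_eq_empty_iff.mpr fun u _ ⟨t, ht, htx, _⟩ => h ⟨t, ht, htx⟩
      simp [this]
  have hbadcard : bad.card ≤ U / 2 := by
    refine (card_biUnion_le_card_mul _ _ _ hBd).trans ?_
    rw [Nat.card_Icc, Nat.add_sub_cancel, Nat.le_div_iff_mul_le (by norm_num), mul_assoc,
      mul_comm D 2]
    exact Nat.div_mul_le_self U (2 * D)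
  have hgood : U - U / 2 ≤ (Icc 1 U \ bad).card := by
    have := le_card_sdiff bad (Icc 1 U)
    rw [Nat.card_Icc, Nat.add_sub_cancel] at this
    lia
  obtain ⟨G, hG, hGc⟩ := exists_subset_card_eq hgood
  refine ⟨G, hG.trans sdiff_subset, hGc, fun u hu d hd hdU t ht htx hut => ?_⟩
  obtain ⟨h1, h2⟩ := mem_sdiff.mp (hG hu)
  refine h2 (mem_biUnion.mpr ⟨d, ?_, mem_filter.mpr ⟨h1, t, ht, htx, hut⟩⟩)
  rw [mem_Icc]
  exact ⟨hd, (Nat.le_div_iff_mul_le (by lia)).mpr hdU⟩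

/-- Either `z` has few representations as a quotient `(b + n) / u`, or it is a quotient of two
small integers. -/
lemma card_representations_le_or {p : ℕ} (z b : ZMod p) {M U R : ℕ} (hR : 0 < R) (hMp : M < p) :
    (((Icc 1 M) ×ˢ (Icc 1 U)).filter fun q : ℕ × ℕ => b + (q.1 : ZMod p) = z * q.2).card ≤ R ∨
      ∃ (d : ℕ) (h : ℤ), 0 < d ∧ d * R ≤ U ∧ |h| ≤ M ∧ z * d = h := by
  rw [or_iff_not_imp_left, not_le]
  intro hcard
  have hcard' : (range R).card < (((Icc 1 M) ×ˢ (Icc 1 U)).filter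
      fun q : ℕ × ℕ => b + (q.1 : ZMod p) = z * q.2).card := by rwa [card_range]
  have hmaps : Set.MapsTo (fun q : ℕ × ℕ => q.2 * R / (U + 1)) (((Icc 1 M) ×ˢ (Icc 1 U)).filter
      fun q : ℕ × ℕ => b + (q.1 : ZMod p) = z * q.2) (range R) := by
    intro q hq
    simp only [coe_filter, mem_product, mem_Icc, Set.mem_ofPred_eq] at hq
    rw [coe_range, Set.mem_Iio, Nat.div_lt_iff_lt_mul (by lia)]
    nlinarith
  obtain ⟨⟨n, u⟩, hq, ⟨n', u'⟩, hq', hne, heq⟩ :=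
    exists_ne_map_eq_of_card_lt_of_maps_to hcard' hmaps
  wlog hlt : u' ≤ u generalizing n u n' u'
  · exact this n' u' hq' n u hq hne.symm heq.symm (by lia)
  simp only [mem_filter, mem_product, mem_Icc] at hq hq' heq
  have hzd : z * ((u - u' : ℕ) : ZMod p) = ((n - n' : ℤ) : ZMod p) := by
    rw [Nat.cast_sub hlt]
    push_cast
    linear_combination hq'.2 - hq.2
  refine ⟨u - u', n - n', ?_, ?_, by rw [abs_le]; lia, hzd⟩
  · rw [Nat.sub_pos_iff_lt]
    refine lt_of_le_of_ne hlt ?_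
    rintro rfl
    rw [Nat.sub_self, Nat.cast_zero, mul_zero] at hzd
    have h0 := (ZMod.intCast_zmod_eq_zero_iff_dvd _ _).mp hzd.symm
    have := Int.eq_zero_of_abs_lt_dvd h0 (by rw [abs_lt]; lia)
    exact hne (by rw [Prod.mk.injEq]; lia)
  · have h1 := Nat.div_add_mod (u * R) (U + 1)
    have h2 := Nat.div_add_mod (u' * R) (U + 1)
    have h3 := Nat.mod_lt (u * R) (Nat.succ_pos U)
    rw [heq] at h1
    rw [Nat.sub_mul]
    simp only [Nat.succ_eq_add_one] at h3
    lia

lemma mul_sum_eq_sum_shift {N U V m : ℕ} (hUV : U * V ≤ N) (G : ℕ → Finset ℕ)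
    (hG : ∀ i ∈ Icc 1 N, G i ⊆ Icc 1 U) (hm : ∀ i ∈ Icc 1 N, (G i).card = m) (F : ℕ → ℂ) :
    ((m * V : ℕ) : ℂ) * ∑ i ∈ Icc 1 N, F i =
      ∑ q ∈ Icc 1 (2 * N) ×ˢ Icc 1 U, ∑ v ∈ (Icc 1 V).filter fun v =>
        N < q.1 + q.2 * v ∧ q.1 + q.2 * v ≤ 2 * N ∧ q.2 ∈ G (q.1 + q.2 * v - N),
          F (q.1 + q.2 * v - N) := by
  have hL : ((m * V : ℕ) : ℂ) * ∑ i ∈ Icc 1 N, F i =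
      ∑ u ∈ Icc 1 U, ∑ v ∈ Icc 1 V, ∑ i ∈ (Icc 1 N).filter fun i => u ∈ G i, F i := by
    rw [mul_sum]
    calc _ = ∑ i ∈ Icc 1 N, ∑ u ∈ Icc 1 U, if u ∈ G i then (V : ℂ) * F i else 0 := by
          refine sum_congr rfl fun i hi => ?_
          rw [← sum_filter, filter_mem_eq_inter, inter_eq_right.mpr (hG i hi), sum_const, hm i hi,
            nsmul_eq_mul]
          push_cast
          ring
      _ = _ := by
          rw [sum_comm]
          refine sum_congr rfl fun u _ => ?_
          rw [sum_const, Nat.card_Icc, Nat.add_sub_cancel, ← sum_filter, nsmul_eq_mul, mul_sum]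
  rw [hL, sum_product_right]
  refine sum_congr rfl fun u hu => ?_
  conv_rhs =>
    simp only [sum_filter]
    rw [sum_comm]
  refine sum_congr rfl fun v hv => ?_
  rw [← sum_filter]
  have huv : u * v ≤ N :=
    (Nat.mul_le_mul (mem_Icc.mp hu).2 (mem_Icc.mp hv).2).trans hUV
  refine sum_nbij' (fun i => i + N - u * v) (fun n => n + u * v - N) ?_ ?_ ?_ ?_ ?_
  · intro i hi
    simp only [mem_filter, mem_Icc] at hi ⊢
    have : i + N - u * v + u * v - N = i := by lia
    rw [this]
    exact ⟨by lia, by lia, by lia, hi.2⟩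
  · intro n hn
    simp only [mem_filter, mem_Icc] at hn ⊢
    exact ⟨by lia, hn.2.2.2⟩
  · intro i hi
    lia
  · intro n hn
    simp only [mem_filter, mem_Icc] at hn
    lia
  · intro i hi
    congr 1
    lia

lemma card_range_subset_pairs_le {ι : Type*} [DecidableEq ι] (k : ℕ) (s : Finset ι) :
    (((Fintype.piFinset fun _ : Fin k => s) ×ˢ Fintype.piFinset fun _ : Fin k => s).filter
      fun vw => ∀ j, ∃ i, vw.1 i = vw.2 j).card ≤ k ^ k * s.card ^ k := by
  have hsub : (((Fintype.piFinset fun _ : Fin k => s) ×ˢ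
      Fintype.piFinset fun _ : Fin k => s).filter fun vw => ∀ j, ∃ i, vw.1 i = vw.2 j) ⊆
      ((Fintype.piFinset fun _ : Fin k => s) ×ˢ (univ : Finset (Fin k → Fin k))).image
        fun vσ => (vσ.1, vσ.1 ∘ vσ.2) := by
    rintro ⟨v, w⟩ h
    obtain ⟨h1, h2⟩ := mem_filter.mp h
    choose σ hσ using h2
    exact mem_image.mpr ⟨(v, σ), mem_product.mpr ⟨(mem_product.mp h1).1, mem_univ _⟩,
      Prod.ext rfl (funext hσ)⟩
  refine (card_le_card hsub).trans (card_image_le.trans ?_)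
  rw [card_product, Fintype.card_piFinset_const, card_univ, Fintype.card_fun, Fintype.card_fin,
    mul_comm]

/-- The pairs of `k`-tuples from `s` solving the shifted reciprocal equation at `z`. -/
def shiftedSolutions {ι F : Type*} [Field F] [DecidableEq F] (k : ℕ) (s : Finset ι) (g : ι → F)
    (z : F) : Finset ((Fin k → ι) × (Fin k → ι)) :=
  ((Fintype.piFinset fun _ : Fin k => s) ×ˢ Fintype.piFinset fun _ : Fin k => s).filter
    fun vw => (∀ i, z + g (vw.1 i) ≠ 0) ∧ (∀ i, z + g (vw.2 i) ≠ 0) ∧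
      ∑ i, (z + g (vw.1 i))⁻¹ = ∑ i, (z + g (vw.2 i))⁻¹

lemma sum_card_shiftedSolutions_le {ι τ F : Type*} [Field F] [Fintype F] [DecidableEq F]
    {k R : ℕ} (hk : ∀ m : ℕ, 0 < m → m ≤ k → (m : F) ≠ 0) (s : Finset ι) (g : ι → F)
    (hg : Set.InjOn g s) (Q : Finset τ) (z : τ → F)
    (hR : ∀ q ∈ Q, (Q.filter fun q' => z q' = z q).card ≤ R) :
    ∑ q ∈ Q, (shiftedSolutions k s g (z q)).card ≤
      Q.card * (k ^ k * s.card ^ k) + s.card ^ (2 * k) * (2 * k * R) := by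
  classical
  set S := (Fintype.piFinset fun _ : Fin k => s) ×ˢ Fintype.piFinset fun _ : Fin k => s with hS
  set T := S.filter fun vw => ∀ j, ∃ i, vw.1 i = vw.2 j with hT
  set P : τ → (Fin k → ι) × (Fin k → ι) → Prop := fun q vw =>
    (∀ i, z q + g (vw.1 i) ≠ 0) ∧ (∀ i, z q + g (vw.2 i) ≠ 0) ∧
      ∑ i, (z q + g (vw.1 i))⁻¹ = ∑ i, (z q + g (vw.2 i))⁻¹ with hP
  have hScard : S.card = s.card ^ (2 * k) := by
    rw [hS, card_product, Fintype.card_piFinset_const, ← pow_add, two_mul]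
  have hsplit : ∀ q ∈ Q, (shiftedSolutions k s g (z q)).card ≤
      k ^ k * s.card ^ k + ((S \ T).filter (P q)).card := by
    intro q _
    have hsub : shiftedSolutions k s g (z q) ⊆ T ∪ (S \ T).filter (P q) := by
      intro vw h
      obtain ⟨h1, h2⟩ := mem_filter.mp h
      by_cases hvw : vw ∈ T
      · exact mem_union_left _ hvw
      · exact mem_union_right _ (mem_filter.mpr ⟨mem_sdiff.mpr ⟨h1, hvw⟩, h2⟩)
    exact (card_le_card hsub).trans ((card_union_le _ _).trans
      (Nat.add_le_add_right (card_range_subset_pairs_le k s) _))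
  have hfib : ∀ vw ∈ S \ T, (Q.filter fun q => P q vw).card ≤ 2 * k * R := by
    rintro ⟨v, w⟩ hvw
    obtain ⟨h1, h2⟩ := mem_sdiff.mp hvw
    simp only [hT, mem_filter, h1, true_and, not_forall, not_exists] at h2
    obtain ⟨j, hj⟩ := h2
    simp only [hS, mem_product, Fintype.mem_piFinset] at h1
    have hroots := card_roots_sum_inv_le hk (g ∘ v) (g ∘ w) j
      fun i h => hj i (hg (h1.1 i) (h1.2 j) h)
    rw [mul_comm]
    refine (card_le_mul_card_image (f := z) _ R ?_).trans (Nat.mul_le_mul_left R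
      ((card_le_card ?_).trans hroots))
    · intro b hb
      obtain ⟨q, hq, rfl⟩ := mem_image.mp hb
      rw [filter_filter]
      refine (card_le_card fun q' hq' => ?_).trans (hR q (mem_filter.mp hq).1)
      obtain ⟨h3, -, h4⟩ := mem_filter.mp hq'
      exact mem_filter.mpr ⟨h3, h4⟩
    · intro b hb
      obtain ⟨q, hq, rfl⟩ := mem_image.mp hb
      exact mem_filter.mpr ⟨mem_univ _, (mem_filter.mp hq).2⟩
  calc _ ≤ ∑ q ∈ Q, (k ^ k * s.card ^ k + ((S \ T).filter (P q)).card) := sum_le_sum hsplit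
    _ = Q.card * (k ^ k * s.card ^ k) + ∑ vw ∈ S \ T, (Q.filter fun q => P q vw).card := by
        rw [sum_add_distrib, sum_const, smul_eq_mul]
        congr 1
        exact sum_card_bipartiteAbove_eq_sum_card_bipartiteBelow P
    _ ≤ Q.card * (k ^ k * s.card ^ k) + S.card * (2 * k * R) := by
        gcongr
        refine (sum_le_card_nsmul _ _ _ hfib).trans ?_
        rw [smul_eq_mul]
        gcongr
        exact sdiff_subset
    _ = _ := by rw [hScard]

/-- The reciprocals of the interval are averaged over the shifts `x ↦ x + u * v`. -/
lemma pow_mul_additiveEnergy_inv_le {p : ℕ} [Fact p.Prime] {k N U V D : ℕ} (hk : 0 < k)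
    (hU : 0 < U) (hV : 0 < V) (hUV : U * V ≤ N) (hp : 7 * k * (N * U) ≤ p) (a : ZMod p)
    (ha : ∀ i ∈ Icc 1 N, a + (i : ZMod p) ≠ 0)
    (hdiv : ∀ n : ℕ, n ≠ 0 → n ≤ 3 * N ^ 2 → n.divisors.card ≤ D) :
    ((U - U / 2) * V) ^ (2 * k) * additiveEnergy k (Icc 1 N) (fun i : ℕ => (a + (i : ZMod p))⁻¹) ≤
      (2 * N * U) ^ (2 * k - 1) *
        (2 * N * U * (k ^ k * V ^ k) + V ^ (2 * k) * (2 * k * (2 * D))) := by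
  classical
  have hprime : p.Prime := Fact.out
  have hUN : U ≤ N := (Nat.le_mul_of_pos_right U hV).trans hUV
  have hVN : V ≤ N := (Nat.le_mul_of_pos_left V hU).trans hUV
  have hN : 0 < N := hU.trans_le hUN
  have hNU : N ≤ N * U := Nat.le_mul_of_pos_right N hU
  have hp7 : 7 * (N * U) ≤ p := by nlinarith
  have hkp : k < p := by nlinarith
  have hD : 0 < D := by
    have := hdiv 1 one_ne_zero (by nlinarith)
    rw [Nat.divisors_one, card_singleton] at this
    exact this
  have hdiv' : ∀ n : ℕ, n ≠ 0 → n ≤ 3 * (N * U) → n.divisors.card ≤ D :=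
    fun n h0 hn => hdiv n h0 (hn.trans (by nlinarith))
  have hcast : ∀ m : ℕ, 0 < m → m < p → (m : ZMod p) ≠ 0 := fun m h0 hm h => by
    rw [ZMod.natCast_eq_zero_iff] at h
    exact absurd (Nat.le_of_dvd h0 h) (by lia)
  have hgood : ∀ i : ℕ, ∃ G : Finset ℕ, i ∈ Icc 1 N → (G ⊆ Icc 1 U ∧ G.card = U - U / 2 ∧
      ∀ u ∈ G, ∀ d : ℕ, 0 < d → d * (2 * D) ≤ U → ∀ t : ℤ, |t| ≤ (3 * (N * U) : ℕ) →
        (t : ZMod p) = (a + (i : ZMod p)) * d → ¬ (u : ℤ) ∣ t) := by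
    intro i
    by_cases hi : i ∈ Icc 1 N
    · obtain ⟨G, h1, h2, h3⟩ := exists_subset_forall_not_dvd hprime hU hD (M := 3 * (N * U))
        (by lia) (by lia) hdiv' (ha i hi)
      exact ⟨G, fun _ => ⟨h1, h2, h3⟩⟩
    · exact ⟨∅, fun h => absurd h hi⟩
  choose G hG using hgood
  set Q := Icc 1 (2 * N) ×ˢ Icc 1 U with hQ
  set s' : ℕ × ℕ → Finset ℕ := fun q => (Icc 1 V).filter fun v =>
    N < q.1 + q.2 * v ∧ q.1 + q.2 * v ≤ 2 * N ∧ q.2 ∈ G (q.1 + q.2 * v - N) with hs'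
  have hHolder := pow_mul_additiveEnergy_le hk ((U - U / 2) * V) (Icc 1 N)
    (fun i : ℕ => (a + (i : ZMod p))⁻¹) Q s'
    (fun q v => (a + ((q.1 + q.2 * v - N : ℕ) : ZMod p))⁻¹)
    (fun ψ => mul_sum_eq_sum_shift hUV G (fun i hi => (hG i hi).1) (fun i hi => (hG i hi).2.1)
      (fun i => ψ (a + (i : ZMod p))⁻¹))
  have hQcard : Q.card = 2 * N * U := by
    rw [hQ, card_product, Nat.card_Icc, Nat.card_Icc, Nat.add_sub_cancel, Nat.add_sub_cancel]
  rw [hQcard] at hHolder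
  refine hHolder.trans (Nat.mul_le_mul_left _ ?_)
  set z : ℕ × ℕ → ZMod p := fun q => (a - N + (q.1 : ZMod p)) / q.2 with hz
  set Q' := Q.filter fun q => (Q.filter fun q' => z q' = z q).card ≤ 2 * D with hQ'
  have hQ0 : ∀ q ∈ Q, (q.2 : ZMod p) ≠ 0 := by
    intro q hq
    have := mem_Icc.mp (mem_product.mp hq).2
    exact hcast _ this.1 (by lia)
  have hzmul : ∀ q ∈ Q, z q * q.2 = a - N + (q.1 : ZMod p) := fun q hq =>
    div_mul_cancel₀ _ (hQ0 q hq)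
  have hshift : ∀ q ∈ Q, ∀ v ∈ s' q, (q.2 : ZMod p) * (z q + v) =
      a + ((q.1 + q.2 * v - N : ℕ) : ZMod p) := by
    intro q hq v hv
    have hv' := (mem_filter.mp hv).2
    rw [Nat.cast_sub hv'.1.le]
    push_cast
    linear_combination hzmul q hq
  have hempty : ∀ q ∈ Q, q ∉ Q' → s' q = ∅ := by
    intro q hq hq'
    by_contra hne
    obtain ⟨v, hv⟩ := nonempty_iff_ne_empty.mpr hne
    rcases card_representations_le_or (z q) (a - N) (M := 2 * N) (U := U) (R := 2 * D)
      (by lia) (by lia) with hcard | ⟨d, h, hd, hdU, hh, hzd⟩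
    · refine hq' (mem_filter.mpr ⟨hq, (card_le_card fun q' hq'' => ?_).trans hcard⟩)
      obtain ⟨h1, h2⟩ := mem_filter.mp hq''
      exact mem_filter.mpr ⟨h1, by rw [← h2, hzmul q' h1]⟩
    · have hv' := mem_filter.mp hv
      have hi : q.1 + q.2 * v - N ∈ Icc 1 N := by rw [mem_Icc]; lia
      have hqU := mem_Icc.mp (mem_product.mp hq).2
      have hvV := mem_Icc.mp hv'.1
      refine (hG _ hi).2.2 q.2 hv'.2.2.2 d hd hdU ((h + v * d) * q.2) ?_ ?_
        (dvd_mul_left _ _)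
      · have hdU' : d ≤ U := (Nat.le_mul_of_pos_right d (by lia)).trans hdU
        have hvd : v * d ≤ N := by
          rw [mul_comm]
          exact (Nat.mul_le_mul hdU' hvV.2).trans hUV
        have h1 : |h + v * d| ≤ ((3 * N : ℕ) : ℤ) := by
          rw [abs_le] at hh ⊢
          have : ((v * d : ℕ) : ℤ) ≤ N := by exact_mod_cast hvd
          have h0 : (0 : ℤ) ≤ ((v * d : ℕ) : ℤ) := by positivity
          push_cast at this h0 hh ⊢
          constructor <;> linarith
        rw [abs_mul, Nat.abs_cast, ← mul_assoc, Nat.cast_mul]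
        exact mul_le_mul h1 (by exact_mod_cast hqU.2) (by positivity) (by positivity)
      · rw [← hshift q hq v hv]
        push_cast
        rw [← hzd]
        ring
  have hbound : ∀ q ∈ Q', additiveEnergy k (s' q)
      (fun v => (a + ((q.1 + q.2 * v - N : ℕ) : ZMod p))⁻¹) ≤
      (shiftedSolutions k (Icc 1 V) (fun v : ℕ => (v : ZMod p)) (z q)).card := by
    intro q hq'
    have hq := (mem_filter.mp hq').1
    refine card_le_card fun vw hvw => ?_
    obtain ⟨h1, h2⟩ := mem_filter.mp hvw
    simp only [mem_product, Fintype.mem_piFinset] at h1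
    have hne : ∀ v ∈ s' q, z q + (v : ZMod p) ≠ 0 := by
      intro v hv h0
      have hv' := mem_filter.mp hv
      have hi : q.1 + q.2 * v - N ∈ Icc 1 N := by rw [mem_Icc]; lia
      refine ha _ hi ?_
      rw [← hshift q hq v hv, h0, mul_zero]
    refine mem_filter.mpr ⟨?_, fun i => hne _ (h1.1 i), fun i => hne _ (h1.2 i), ?_⟩
    · simp only [mem_product, Fintype.mem_piFinset]
      exact ⟨fun i => (mem_filter.mp (h1.1 i)).1, fun i => (mem_filter.mp (h1.2 i)).1⟩
    · have hinv : ∀ v ∈ s' q, (a + ((q.1 + q.2 * v - N : ℕ) : ZMod p))⁻¹ =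
          (q.2 : ZMod p)⁻¹ * (z q + v)⁻¹ := by
        intro v hv
        rw [← hshift q hq v hv, mul_inv]
      rw [sum_congr rfl fun i _ => hinv _ (h1.1 i), sum_congr rfl fun i _ => hinv _ (h1.2 i),
        ← mul_sum, ← mul_sum] at h2
      exact mul_left_cancel₀ (inv_ne_zero (hQ0 q hq)) h2
  have hinj : Set.InjOn (fun v : ℕ => (v : ZMod p)) (Icc 1 V) := by
    intro v hv w hw h
    simp only [coe_Icc, Set.mem_Icc] at hv hw
    have := (ZMod.natCast_eq_natCast_iff' _ _ _).mp h
    rwa [Nat.mod_eq_of_lt (by lia), Nat.mod_eq_of_lt (by lia)] at this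
  have hsum := sum_card_shiftedSolutions_le (k := k) (R := 2 * D)
    (fun m h0 hm => hcast m h0 (by lia)) (Icc 1 V) (fun v : ℕ => (v : ZMod p)) hinj Q' z
    (fun q hq => (card_le_card (filter_subset_filter _ (filter_subset _ _))).trans
      (mem_filter.mp hq).2)
  rw [Nat.card_Icc, Nat.add_sub_cancel] at hsum
  calc _ = ∑ q ∈ Q', additiveEnergy k (s' q)
        (fun v => (a + ((q.1 + q.2 * v - N : ℕ) : ZMod p))⁻¹) := by
        refine (sum_subset (filter_subset _ _) fun q hq hq' => ?_).symm
        rw [hempty q hq hq', additiveEnergy, card_eq_zero]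
        have : Nonempty (Fin k) := ⟨⟨0, hk⟩⟩
        simp
    _ ≤ ∑ q ∈ Q', (shiftedSolutions k (Icc 1 V) (fun v : ℕ => (v : ZMod p)) (z q)).card :=
        sum_le_sum hbound
    _ ≤ _ := hsum
    _ ≤ _ := by
        gcongr
        rw [← hQcard]
        exact card_le_card (filter_subset _ _)

lemma additiveEnergy_image_le {ι κ G : Type*} [AddCommMonoid G] [DecidableEq G] [DecidableEq κ]
    (k : ℕ) (s : Finset ι) (g : ι → κ) (f : κ → G) :
    additiveEnergy k (s.image g) f ≤ additiveEnergy k s (fun i => f (g i)) := by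
  classical
  refine (card_le_card (t := Finset.image (fun xy : (Fin k → ι) × (Fin k → ι) =>
    ((fun i => g (xy.1 i) : Fin k → κ), (fun i => g (xy.2 i) : Fin k → κ)))
    (((Fintype.piFinset fun _ : Fin k => s) ×ˢ Fintype.piFinset fun _ : Fin k => s).filter
      (fun xy => ∑ i, f (g (xy.1 i)) = ∑ i, f (g (xy.2 i))))) ?_).trans card_image_le
  rintro ⟨x, y⟩ h
  simp only [mem_filter, mem_product, Fintype.mem_piFinset, mem_image] at h
  choose x' hx' hx using h.1.1
  choose y' hy' hy using h.1.2
  refine mem_image.mpr ⟨(x', y'), ?_, Prod.ext (funext hx) (funext hy)⟩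
  simp only [mem_filter, mem_product, Fintype.mem_piFinset, hx, hy]
  exact ⟨⟨hx', hy'⟩, h.2⟩

lemma lt_of_zero_notMem_interval {p : ℕ} [Fact p.Prime] {a : ZMod p} {N : ℕ}
    (h : (0 : ZMod p) ∉ interval p a N) : N < p := by
  by_contra! hN
  have hp : 0 < p := (Fact.out : p.Prime).pos
  refine h (mem_image.mpr ⟨p - a.val, ?_, ?_⟩)
  · have := ZMod.val_lt a
    rw [mem_Icc]
    lia
  · rw [Nat.cast_sub (ZMod.val_lt a).le]
    simp

lemma card_interval {p : ℕ} [Fact p.Prime] {a : ZMod p} {N : ℕ} (hN : N < p) :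
    (interval p a N).card = N := by
  rw [interval, card_image_of_injOn, Nat.card_Icc, Nat.add_sub_cancel]
  intro v hv w hw h
  simp only [coe_Icc, Set.mem_Icc] at hv hw
  have := (ZMod.natCast_eq_natCast_iff' _ _ _).mp (add_left_cancel h)
  rwa [Nat.mod_eq_of_lt (by lia), Nat.mod_eq_of_lt (by lia)] at this

/-- Parameters `U`, `V` balancing the two terms of `pow_mul_additiveEnergy_inv_le`. -/
lemma exists_shift_parameters {k N p : ℕ} (hk : 0 < k) (hN : 0 < N) (hp : 0 < p)
    (hNp : 7 * k * N ≤ p) {X : ℝ} (hX : X = (N : ℝ) ^ ((2 * (k : ℝ) ^ 2) / ((k : ℝ) + 1)) +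
      (N : ℝ) ^ (2 * k) / (p : ℝ)) :
    ∃ U V : ℕ, 0 < U ∧ 0 < V ∧ U * V ≤ N ∧ 7 * k * (N * U) ≤ p ∧
      (N : ℝ) ^ (2 * k) ≤ (2 * (V : ℝ)) ^ k * X ∧
      (N : ℝ) ^ (2 * k - 1) ≤ 2 * (U : ℝ) * (7 * k) * X := by
  have hN1 : (1 : ℝ) ≤ N := by exact_mod_cast hN
  have hN0 : (0 : ℝ) < N := by linarith
  have hp1 : (1 : ℝ) ≤ p := by exact_mod_cast hp
  have hp0 : (0 : ℝ) < p := by linarith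
  have hk1 : (1 : ℝ) ≤ k := by exact_mod_cast hk
  have hk0 : (0 : ℝ) < k := by linarith
  set X₁ : ℝ := (N : ℝ) ^ ((2 * (k : ℝ) ^ 2) / ((k : ℝ) + 1)) with hX₁
  set X₂ : ℝ := (N : ℝ) ^ (2 * k) / (p : ℝ) with hX₂
  have hX₁0 : 0 < X₁ := by positivity
  have hX₂0 : 0 < X₂ := by positivity
  set A : ℝ := (N : ℝ) ^ (((k : ℝ) - 1) / ((k : ℝ) + 1)) with hA
  set B : ℝ := (N : ℝ) ^ (2 / ((k : ℝ) + 1)) with hB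
  set A' : ℝ := p / (7 * k * N) with hA'
  set B' : ℝ := (p : ℝ) ^ (1 / (k : ℝ)) with hB'
  have hA1 : 1 ≤ A := Real.one_le_rpow hN1 (div_nonneg (by linarith) (by linarith))
  have hB1 : 1 ≤ B := Real.one_le_rpow hN1 (by positivity)
  have hB'1 : 1 ≤ B' := Real.one_le_rpow hp1 (by positivity)
  have hA'1 : 1 ≤ A' := by
    rw [hA', le_div_iff₀ (by positivity), one_mul]
    exact_mod_cast hNp
  have hAB : A * B = N := by
    rw [hA, hB, ← Real.rpow_add hN0, ← add_div,
      show (k : ℝ) - 1 + 2 = k + 1 by ring, div_self (by positivity), Real.rpow_one]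
  have hBX : B ^ k * X₁ = (N : ℝ) ^ (2 * k) := by
    rw [hB, hX₁, ← Real.rpow_natCast _ k, ← Real.rpow_mul hN0.le, ← Real.rpow_add hN0,
      ← Real.rpow_natCast (N : ℝ) (2 * k)]
    congr 1
    push_cast
    field_simp
    ring
  have hAX : A * X₁ = (N : ℝ) ^ (2 * k - 1) := by
    rw [hA, hX₁, ← Real.rpow_add hN0, ← Real.rpow_natCast (N : ℝ) (2 * k - 1),
      Nat.cast_sub (by lia)]
    congr 1
    push_cast
    field_simp
    ring
  have hB'X : B' ^ k * X₂ = (N : ℝ) ^ (2 * k) := by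
    rw [hB', hX₂, ← Real.rpow_natCast _ k, ← Real.rpow_mul hp0.le, one_div_mul_cancel hk0.ne',
      Real.rpow_one]
    field_simp
  have hA'X : A' * (7 * k) * X₂ = (N : ℝ) ^ (2 * k - 1) := by
    have : (N : ℝ) ^ (2 * k) = (N : ℝ) ^ (2 * k - 1) * N := by
      rw [← pow_succ]
      congr 1
      lia
    rw [hA', hX₂, this]
    field_simp
  have hfloor : ∀ y : ℝ, 1 ≤ y → 0 < ⌊y⌋₊ ∧ (⌊y⌋₊ : ℝ) ≤ y ∧ y ≤ 2 * (⌊y⌋₊ : ℝ) := by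
    intro y hy
    have h1 : 1 ≤ ⌊y⌋₊ := (Nat.one_le_floor_iff y).mpr hy
    have h2 := Nat.lt_floor_add_one y
    have h3 : (1 : ℝ) ≤ (⌊y⌋₊ : ℝ) := by exact_mod_cast h1
    exact ⟨h1, Nat.floor_le (by linarith), by linarith⟩
  obtain ⟨hU0, hU1, hU2⟩ := hfloor (min A A') (le_min hA1 hA'1)
  obtain ⟨hV0, hV1, hV2⟩ := hfloor (min B B') (le_min hB1 hB'1)
  refine ⟨⌊min A A'⌋₊, ⌊min B B'⌋₊, hU0, hV0, ?_, ?_, ?_, ?_⟩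
  · have : (⌊min A A'⌋₊ : ℝ) * (⌊min B B'⌋₊ : ℝ) ≤ N := by
      rw [← hAB]
      exact mul_le_mul (hU1.trans (min_le_left _ _)) (hV1.trans (min_le_left _ _))
        (by positivity) (by positivity)
    exact_mod_cast this
  · have h := hU1.trans (min_le_right _ _)
    rw [hA', le_div_iff₀ (by positivity)] at h
    have : 7 * (k : ℝ) * (N * (⌊min A A'⌋₊ : ℝ)) ≤ p := by linarith
    exact_mod_cast this
  · refine le_trans ?_ (mul_le_mul_of_nonneg_right
      (pow_le_pow_left₀ (le_min (by linarith) (by linarith)) hV2 k) (by rw [hX]; positivity))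
    rw [hX, mul_add]
    rcases min_choice B B' with h | h <;> rw [h]
    · rw [hBX]
      linarith [mul_pos (pow_pos (by linarith : 0 < B) k) hX₂0]
    · rw [hB'X]
      linarith [mul_pos (pow_pos (by linarith : 0 < B') k) hX₁0]
  · have h7 : (0 : ℝ) < 7 * k := by positivity
    have hX0 : 0 < X := by rw [hX]; positivity
    refine le_trans ?_ (mul_le_mul_of_nonneg_right
      (mul_le_mul_of_nonneg_right hU2 h7.le) hX0.le)
    rw [hX, mul_add]
    rcases min_choice A A' with h | h <;> rw [h]
    · have h1 : A * X₁ ≤ A * (7 * k) * X₁ := by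
        have : 0 < A * X₁ := by positivity
        nlinarith
      have h2 : 0 < A * (7 * k) * X₂ := by positivity
      linarith
    · rw [hA'X]
      have : 0 < A' * (7 * k) * X₁ := by positivity
      linarith

lemma additiveEnergy_inv_le {p : ℕ} [Fact p.Prime] {k N D : ℕ} (hk : 0 < k) (hN : 0 < N)
    (hNp : 7 * k * N ≤ p) (a : ZMod p) (ha : ∀ i ∈ Icc 1 N, a + (i : ZMod p) ≠ 0)
    (hdiv : ∀ n : ℕ, n ≠ 0 → n ≤ 3 * N ^ 2 → n.divisors.card ≤ D) {X : ℝ}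
    (hX : X = (N : ℝ) ^ ((2 * (k : ℝ) ^ 2) / ((k : ℝ) + 1)) + (N : ℝ) ^ (2 * k) / (p : ℝ)) :
    (additiveEnergy k (Icc 1 N) (fun i : ℕ => (a + (i : ZMod p))⁻¹) : ℝ) ≤
      2 ^ (4 * k) * (2 ^ k * k ^ k + 28 * k ^ 2 * D) * X := by
  obtain ⟨U, V, hU, hV, hUV, hp, h1, h2⟩ :=
    exists_shift_parameters hk hN (Fact.out : p.Prime).pos hNp hX
  have hmain := pow_mul_additiveEnergy_inv_le hk hU hV hUV hp a ha hdiv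
  set E := additiveEnergy k (Icc 1 N) (fun i : ℕ => (a + (i : ZMod p))⁻¹)
  have hU0 : (0 : ℝ) < U := by exact_mod_cast hU
  have hV0 : (0 : ℝ) < V := by exact_mod_cast hV
  have hX0 : 0 ≤ X := by rw [hX]; positivity
  have hhalf : ((U : ℝ) * V) ^ (2 * k) * E ≤
      2 ^ (2 * k) * ((((U - U / 2) * V) ^ (2 * k) * E : ℕ) : ℝ) := by
    rw [Nat.cast_mul, ← mul_assoc]
    refine mul_le_mul_of_nonneg_right ?_ (Nat.cast_nonneg E)
    rw [Nat.cast_pow, ← mul_pow]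
    refine pow_le_pow_left₀ (by positivity) ?_ _
    have : U * V ≤ 2 * ((U - U / 2) * V) := by
      rw [← mul_assoc]
      exact Nat.mul_le_mul_right V (by lia)
    exact_mod_cast this
  have hmain' : ((((U - U / 2) * V) ^ (2 * k) * E : ℕ) : ℝ) ≤
      (2 * N * U : ℝ) ^ (2 * k - 1) *
        (2 * N * U * (k ^ k * V ^ k) + V ^ (2 * k) * (2 * k * (2 * D))) := by
    exact_mod_cast hmain
  obtain ⟨m, hm⟩ : ∃ m, 2 * k = m + 1 := ⟨2 * k - 1, by lia⟩
  have hfirst : (2 * N * U : ℝ) ^ (2 * k - 1) * (2 * N * U * (k ^ k * V ^ k)) ≤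
      2 ^ (2 * k) * (2 ^ k * k ^ k) * X * ((U : ℝ) * V) ^ (2 * k) := by
    calc (2 * N * U : ℝ) ^ (2 * k - 1) * (2 * N * U * (k ^ k * V ^ k))
        = 2 ^ (2 * k) * U ^ (2 * k) * k ^ k * V ^ k * (N : ℝ) ^ (2 * k) := by
          rw [hm, Nat.add_sub_cancel, ← mul_assoc, ← pow_succ, mul_pow, mul_pow]
          ring
      _ ≤ 2 ^ (2 * k) * U ^ (2 * k) * k ^ k * V ^ k * ((2 * (V : ℝ)) ^ k * X) := by gcongr
      _ = _ := by
          rw [mul_pow, mul_pow, two_mul k, pow_add (V : ℝ)]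
          ring
  have hsecond : (2 * N * U : ℝ) ^ (2 * k - 1) * (V ^ (2 * k) * (2 * k * (2 * D))) ≤
      2 ^ (2 * k) * (28 * k ^ 2 * D) * X * ((U : ℝ) * V) ^ (2 * k) := by
    calc (2 * N * U : ℝ) ^ (2 * k - 1) * (V ^ (2 * k) * (2 * k * (2 * D)))
        = 2 ^ (2 * k - 1) * U ^ (2 * k - 1) * (V ^ (2 * k) * (2 * k * (2 * D))) *
            (N : ℝ) ^ (2 * k - 1) := by
          rw [mul_pow, mul_pow]
          ring
      _ ≤ 2 ^ (2 * k - 1) * U ^ (2 * k - 1) * (V ^ (2 * k) * (2 * k * (2 * D))) *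
            (2 * (U : ℝ) * (7 * k) * X) := by gcongr
      _ = _ := by
          rw [hm, Nat.add_sub_cancel]
          ring
  have hUVpos : 0 < ((U : ℝ) * V) ^ (2 * k) := by positivity
  refine le_of_mul_le_mul_left ?_ hUVpos
  calc ((U : ℝ) * V) ^ (2 * k) * E
      ≤ 2 ^ (2 * k) * ((2 * N * U : ℝ) ^ (2 * k - 1) *
        (2 * N * U * (k ^ k * V ^ k) + V ^ (2 * k) * (2 * k * (2 * D)))) :=
        hhalf.trans (by gcongr)
    _ ≤ 2 ^ (2 * k) * (2 ^ (2 * k) * (2 ^ k * k ^ k) * X * ((U : ℝ) * V) ^ (2 * k) +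
          2 ^ (2 * k) * (28 * k ^ 2 * D) * X * ((U : ℝ) * V) ^ (2 * k)) := by
        rw [mul_add]
        gcongr
    _ = _ := by
        rw [show 4 * k = 2 * k + 2 * k by ring, pow_add (2 : ℝ)]
        ring

/-- for fixed `k ≥ 1` and `ε > 0` there is `C > 0` such that for every prime `p`
and every interval `I ⊂ F_p` not containing `0`, the number `J_{2k}` of tuples
`(x_1,…,x_{2k}) ∈ I^{2k}` with `x_1⁻¹+…+x_k⁻¹ = x_{k+1}⁻¹+…+x_{2k}⁻¹` satisfies
`J_{2k} ≤ C·(|I|^{2k²/(k+1)} + |I|^{2k}/p)·|I|^ε`. -/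
theorem stmt_0 (k : ℕ) (hk : 0 < k) (ε : ℝ) (hε : 0 < ε) :
    ∃ C : ℝ, 0 < C ∧
      ∀ (p : ℕ), p.Prime → ∀ (a : ZMod p) (N : ℕ),
        (0 : ZMod p) ∉ interval p a N →
        ((((Fintype.piFinset fun _ : Fin k => interval p a N) ×ˢ
              Fintype.piFinset fun _ : Fin k => interval p a N).filter
            (fun xy => (∑ i, (xy.1 i)⁻¹) = ∑ i, (xy.2 i)⁻¹)).card : ℝ) ≤
          C * (((interval p a N).card : ℝ) ^ ((2 * (k : ℝ) ^ 2) / ((k : ℝ) + 1)) +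
              ((interval p a N).card : ℝ) ^ (2 * k) / (p : ℝ)) *
            ((interval p a N).card : ℝ) ^ ε := by
  obtain ⟨C₁, hC₁, hdivisors⟩ := exists_card_divisors_le (ε / 2) (by positivity)
  set K : ℝ := C₁ * 3 ^ (ε / 2) with hK
  have hK0 : 0 < K := by positivity
  set C : ℝ := 2 ^ (4 * k) * (2 ^ k * k ^ k + 28 * k ^ 2 * K) + 7 * k with hC
  have hk0 : (0 : ℝ) < k := by exact_mod_cast hk
  have hC0 : 0 < C := by positivity
  refine ⟨C, hC0, fun p hp a N h0 => ?_⟩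
  have := Fact.mk hp
  change (additiveEnergy k (interval p a N) (fun x => x⁻¹) : ℝ) ≤ _
  have htriv := additiveEnergy_le_of_injOn hk (interval p a N) (fun x => x⁻¹)
    inv_injective.injOn
  have hNp := lt_of_zero_notMem_interval h0
  rw [card_interval hNp] at htriv ⊢
  have hp0 : (0 : ℝ) < p := by exact_mod_cast hp.pos
  set X : ℝ := (N : ℝ) ^ ((2 * (k : ℝ) ^ 2) / ((k : ℝ) + 1)) + (N : ℝ) ^ (2 * k) / (p : ℝ)
    with hX
  have hX0 : 0 ≤ X := by positivity
  rcases Nat.eq_zero_or_pos N with rfl | hN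
  · rw [zero_pow (by lia), Nat.le_zero] at htriv
    rw [htriv, Nat.cast_zero]
    positivity
  have hN1 : (1 : ℝ) ≤ N := by exact_mod_cast hN
  have hNε : (1 : ℝ) ≤ (N : ℝ) ^ ε := Real.one_le_rpow hN1 hε.le
  rcases le_or_gt (7 * k * N) p with hlarge | hsmall
  · have himage : additiveEnergy k (interval p a N) (fun x => x⁻¹) ≤
        additiveEnergy k (Icc 1 N) (fun i : ℕ => (a + (i : ZMod p))⁻¹) :=
      additiveEnergy_image_le k (Icc 1 N) (fun i : ℕ => a + (i : ZMod p)) (fun x => x⁻¹)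
    have hdiv : ∀ n : ℕ, n ≠ 0 → n ≤ 3 * N ^ 2 → n.divisors.card ≤ ⌊K * (N : ℝ) ^ ε⌋₊ := by
      intro n hn hnN
      refine Nat.le_floor ((hdivisors n hn).trans ?_)
      have hnN' : (n : ℝ) ≤ 3 * (N : ℝ) ^ 2 := by exact_mod_cast hnN
      calc C₁ * (n : ℝ) ^ (ε / 2) ≤ C₁ * (3 * (N : ℝ) ^ 2) ^ (ε / 2) := by gcongr
        _ = K * (N : ℝ) ^ ε := by
          rw [Real.mul_rpow (by norm_num) (by positivity), ← Real.rpow_natCast,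
            ← Real.rpow_mul (by positivity), hK, mul_assoc, Nat.cast_ofNat,
            mul_div_cancel₀ ε two_ne_zero]
    have hmain := additiveEnergy_inv_le hk hN hlarge a
      (fun i hi h => h0 (mem_image.mpr ⟨i, hi, h⟩)) hdiv hX
    have hfloor : (⌊K * (N : ℝ) ^ ε⌋₊ : ℝ) ≤ K * (N : ℝ) ^ ε := Nat.floor_le (by positivity)
    calc (additiveEnergy k (interval p a N) (fun x => x⁻¹) : ℝ)
        ≤ additiveEnergy k (Icc 1 N) (fun i : ℕ => (a + (i : ZMod p))⁻¹) := by
          exact_mod_cast himage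
      _ ≤ 2 ^ (4 * k) * (2 ^ k * k ^ k + 28 * k ^ 2 * (⌊K * (N : ℝ) ^ ε⌋₊ : ℝ)) * X := hmain
      _ ≤ 2 ^ (4 * k) * (2 ^ k * k ^ k * (N : ℝ) ^ ε + 28 * k ^ 2 * (K * (N : ℝ) ^ ε)) * X := by
          have : (2 : ℝ) ^ k * k ^ k ≤ 2 ^ k * k ^ k * (N : ℝ) ^ ε :=
            le_mul_of_one_le_right (by positivity) hNε
          gcongr
      _ = 2 ^ (4 * k) * (2 ^ k * k ^ k + 28 * k ^ 2 * K) * X * (N : ℝ) ^ ε := by ring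
      _ ≤ C * X * (N : ℝ) ^ ε := by
          gcongr
          rw [hC]
          linarith
  · have hsmall' : (p : ℝ) ≤ 7 * k * N := by exact_mod_cast hsmall.le
    calc (additiveEnergy k (interval p a N) (fun x => x⁻¹) : ℝ)
        ≤ (N : ℝ) ^ (2 * k - 1) := by exact_mod_cast htriv
      _ ≤ 7 * k * ((N : ℝ) ^ (2 * k) / p) := by
          have : (N : ℝ) ^ (2 * k) = (N : ℝ) ^ (2 * k - 1) * N := by
            rw [← pow_succ]
            congr 1
            lia
          rw [this, ← mul_div_assoc, le_div_iff₀ hp0]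
          calc (N : ℝ) ^ (2 * k - 1) * p ≤ (N : ℝ) ^ (2 * k - 1) * (7 * k * N) := by gcongr
            _ = _ := by ring
      _ ≤ C * X := by
          have h1 : 7 * (k : ℝ) ≤ C := by
            rw [hC]
            have : (0 : ℝ) < 2 ^ (4 * k) * (2 ^ k * k ^ k + 28 * k ^ 2 * K) := by positivity
            linarith
          have h2 : (N : ℝ) ^ (2 * k) / p ≤ X := by
            rw [hX]
            have : (0 : ℝ) ≤ (N : ℝ) ^ ((2 * (k : ℝ) ^ 2) / ((k : ℝ) + 1)) := by positivity
            linarith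
          exact mul_le_mul h1 h2 (by positivity) hC0.le
      _ ≤ C * X * (N : ℝ) ^ ε := le_mul_of_one_le_right (by positivity) hNε
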